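/- For the StackMST(0,0) game whose red tree is a path P with exactly 3 or exactly 4 edges and nonnegative edge costs, the optimal revenue satisfies r*(P, c) ≥ (4/7)·c(P). -/

import Mathlib

namespace StackMST

variable {V : Type*}

/-- Sum of an edge-weight function over a set of edges. -/
noncomputable def esum (w : Sym2 V → ℝ) (s : Set (Sym2 V)) : ℝ := ∑ᶠ e ∈ s, w e

/-- `M` is a spanning tree of `G`. -/
def IsSpanningTreeOf (G M : SimpleGraph V) : Prop := M ≤ G ∧ M.IsTree

/-- Total weight of `M`, where red edges (the edges of `T`) are weighted by `c`
and all other (blue) edges are weighted by `p`. -/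
noncomputable def weight (T : SimpleGraph V) (c p : Sym2 V → ℝ) (M : SimpleGraph V) : ℝ :=
  esum c (M.edgeSet ∩ T.edgeSet) + esum p (M.edgeSet \ T.edgeSet)

/-- Total price of the blue edges of `M`. -/
noncomputable def blueRevenue (T : SimpleGraph V) (p : Sym2 V → ℝ) (M : SimpleGraph V) : ℝ :=
  esum p (M.edgeSet \ T.edgeSet)

/-- The leader's revenue once `F` and `p` are fixed: the follower selects a
minimum-weight spanning tree of `T ⊔ F` and, among those, one maximizing the
total price of the blue edges it contains. -/
noncomputable def followerRevenue (T : SimpleGraph V) (c : Sym2 V → ℝ)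
    (F : SimpleGraph V) (p : Sym2 V → ℝ) : ℝ :=
  sSup {r | ∃ M : SimpleGraph V, IsSpanningTreeOf (T ⊔ F) M ∧
    (∀ M' : SimpleGraph V, IsSpanningTreeOf (T ⊔ F) M' →
        weight T c p M ≤ weight T c p M') ∧
    r = blueRevenue T p M}

/-- `F` is a set of blue edges: none of its edges is a red edge. -/
def IsBlueSet (T F : SimpleGraph V) : Prop := F ≤ Tᶜ

/-- `r(F)`: the best revenue the leader can obtain from the activated set `F`. -/
noncomputable def revenueOf (T : SimpleGraph V) (c : Sym2 V → ℝ) (F : SimpleGraph V) : ℝ :=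
  sSup {r | ∃ p : Sym2 V → ℝ, (∀ e ∈ F.edgeSet, 0 ≤ p e) ∧ r = followerRevenue T c F p}

/-- Optimal revenue `r*(T, c)` of the StackMST(0,0) game on the red tree `T`. -/
noncomputable def optRevenue (T : SimpleGraph V) (c : Sym2 V → ℝ) : ℝ :=
  sSup {r | ∃ (F : SimpleGraph V) (p : Sym2 V → ℝ), IsBlueSet T F ∧
    (∀ e ∈ F.edgeSet, 0 ≤ p e) ∧ r = followerRevenue T c F p}

/-- Total cost `c(T)` of the red edges. -/
noncomputable def redCost (T : SimpleGraph V) (c : Sym2 V → ℝ) : ℝ := esum c T.edgeSet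

/-- Optimal revenue of the budgeted game StackMST(γ, Δ). -/
noncomputable def gammaOptRevenue (T : SimpleGraph V) (c γ : Sym2 V → ℝ) (Δ : ℝ) : ℝ :=
  sSup {r | ∃ F : SimpleGraph V, IsBlueSet T F ∧ esum γ F.edgeSet ≤ Δ ∧
    r = revenueOf T c F}

end StackMST

open StackMST
open SimpleGraph

section General

variable {V : Type*}

/-- An acyclic graph with `|V| - 1` edges is a tree. -/
lemma isTree_of_acyclic_card [Fintype V] [Nonempty V] {H : SimpleGraph V}
    (hH : H.IsAcyclic) (hcard : H.edgeSet.ncard + 1 = Fintype.card V) : H.IsTree := by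
  classical
  obtain ⟨T, hle, -, hT⟩ := SimpleGraph.Connected.exists_isTree_le_of_le_of_isAcyclic
    (SimpleGraph.connected_top (V := V)) (le_top : H ≤ ⊤) hH
  have h1 := (isTree_iff_connected_and_card.1 hT).2
  rw [Nat.card_eq_fintype_card (α := V)] at h1
  have h2 : H.edgeSet = T.edgeSet := by
    apply Set.eq_of_subset_of_ncard_le (edgeSet_subset_edgeSet.2 hle)
    have : T.edgeSet.ncard = Nat.card T.edgeSet := rfl
    omega
  rw [edgeSet_inj.1 h2]
  exact hT

lemma ncard_of_isTree [Fintype V] {H : SimpleGraph V} (hH : H.IsTree) :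
    H.edgeSet.ncard + 1 = Fintype.card V := by
  have h1 := (isTree_iff_connected_and_card.1 hH).2
  rw [Nat.card_eq_fintype_card (α := V)] at h1
  exact h1

lemma esum_eq [Fintype V] (w : Sym2 V → ℝ) (s : Set (Sym2 V)) :
    esum w s = ∑ e ∈ s.toFinite.toFinset, w e := by
  unfold esum
  rw [finsum_mem_eq_finite_toFinset_sum]

lemma esum_nonneg [Fintype V] {w : Sym2 V → ℝ} {s : Set (Sym2 V)}
    (h : ∀ e ∈ s, 0 ≤ w e) : 0 ≤ esum w s := by
  rw [esum_eq]
  exact Finset.sum_nonneg fun e he => h e (by simpa using he)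

lemma weight_eq [Fintype V] (T M : SimpleGraph V) (c p w : Sym2 V → ℝ)
    (h1 : ∀ e ∈ T.edgeSet, w e = c e) (h2 : ∀ e ∉ T.edgeSet, w e = p e) :
    weight T c p M = esum w M.edgeSet := by
  unfold weight esum
  rw [← finsum_mem_inter_add_sdiff T.edgeSet (s := M.edgeSet) (f := w) (Set.toFinite _)]
  congr 1
  · exact finsum_mem_congr rfl fun e he => (h1 e he.2).symm
  · exact finsum_mem_congr rfl fun e he => (h2 e he.2).symm

/-- Exchange step: swapping `f` on the tree path for `e = s(a,b)` crossing the cut `A`. -/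
lemma exchange_step [Fintype V] {M' : SimpleGraph V} (hM' : M'.IsTree) {a b : V} (A : Set V)
    (ha : a ∈ A) (hb : b ∉ A) (hab : ¬ M'.Adj a b) :
    ∃ u v, M'.Adj u v ∧ u ∈ A ∧ v ∉ A ∧ ∃ M'' : SimpleGraph V, M''.IsTree ∧
      M''.edgeSet = insert s(a, b) (M'.edgeSet \ {s(u, v)}) := by
  classical
  have hne : a ≠ b := fun h => hb (h ▸ ha)
  obtain ⟨P, hP, huniq⟩ := hM'.existsUnique_path a b
  obtain ⟨d, hd, hd1, hd2⟩ := P.exists_boundary_dart A ha hb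
  refine ⟨d.fst, d.snd, d.adj, hd1, hd2, (M'.deleteEdges {s(d.fst, d.snd)}) ⊔ edge a b, ?_, ?_⟩
  swap
  · rw [edgeSet_sup, edgeSet_deleteEdges, edgeSet_edge_of_ne hne, Set.union_comm]; rfl
  have hnr : ¬ (M'.deleteEdges {s(d.fst, d.snd)}).Reachable a b := by
    intro hr
    obtain ⟨Q, hQ⟩ := hr.exists_isPath
    have hle : M'.deleteEdges {s(d.fst, d.snd)} ≤ M' := deleteEdges_le _
    have h1 := huniq (Q.mapLe hle) (hQ.mapLe hle)
    have h2 : s(d.fst, d.snd) ∈ P.edges := List.mem_map_of_mem (f := Dart.edge) hd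
    rw [← h1] at h2
    simp only [Walk.edges_mapLe_eq_edges] at h2
    have h3 := Q.edges_subset_edgeSet h2
    rw [edgeSet_deleteEdges] at h3
    exact h3.2 rfl
  have : Nonempty V := ⟨a⟩
  apply isTree_of_acyclic_card
  · exact IsAcyclic.sup_edge_of_not_reachable hnr (hM'.isAcyclic.anti (deleteEdges_le _))
  · rw [edgeSet_sup, edgeSet_deleteEdges, edgeSet_edge_of_ne hne, Set.union_comm]
    have h1 := ncard_of_isTree hM'
    have h2 : s(a, b) ∉ M'.edgeSet \ {s(d.fst, d.snd)} := fun h => hab h.1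
    have h3 : s(d.fst, d.snd) ∈ M'.edgeSet := d.adj
    have := Set.ncard_sdiff_singleton_add_one h3
    rw [Set.singleton_union, Set.ncard_insert_of_notMem h2]
    omega

/-- Cut optimality criterion for minimum spanning trees. -/
lemma mst_of_cuts [Fintype V] {G M : SimpleGraph V} (hM : M.IsTree) (hMG : M ≤ G)
    (w : Sym2 V → ℝ)
    (hcut : ∀ a b, M.Adj a b → ∃ A : Set V, a ∈ A ∧ b ∉ A ∧
      (∀ u v, M.Adj u v → u ∈ A → v ∉ A → s(u, v) = s(a, b)) ∧
      (∀ u v, G.Adj u v → u ∈ A → v ∉ A → w s(a, b) ≤ w s(u, v))) :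
    ∀ (k : ℕ) (M' : SimpleGraph V), (M.edgeSet \ M'.edgeSet).ncard = k → M'.IsTree → M' ≤ G →
      esum w M.edgeSet ≤ esum w M'.edgeSet := by
  classical
  intro k
  induction k with
  | zero =>
    intro M' hk hM' _
    rw [Set.ncard_eq_zero, Set.sdiff_eq_empty] at hk
    have h1 := ncard_of_isTree hM
    have h2 := ncard_of_isTree hM'
    rw [Set.eq_of_subset_of_ncard_le hk (by omega)]
  | succ k ih =>
    intro M' hk hM' hM'G
    have hne : (M.edgeSet \ M'.edgeSet).Nonempty := by
      rw [← Set.ncard_pos]; omega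
    obtain ⟨e, he, he'⟩ := hne
    induction e with | _ a b
    obtain ⟨A, ha, hb, h1, h2⟩ := hcut a b he
    obtain ⟨u, v, huv, hu, hv, M'', hT, hE⟩ := exchange_step hM' A ha hb he'
    have hf : s(u, v) ∉ M.edgeSet := by
      intro h
      have := h1 u v h hu hv
      rw [← this] at he'
      exact he' huv
    have h3 := ih M'' ?_ hT ?_
    · refine h3.trans ?_
      have hle := h2 u v (hM'G huv) hu hv
      have e1 : s(a, b) ∉ M'.edgeSet \ {s(u, v)} := fun h => he' h.1
      have e2 : esum w M''.edgeSet = w s(a, b) + esum w (M'.edgeSet \ {s(u, v)}) := by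
        rw [hE]; exact finsum_mem_insert _ e1 (Set.toFinite _)
      have e3 : esum w M'.edgeSet = w s(u, v) + esum w (M'.edgeSet \ {s(u, v)}) := by
        have : M'.edgeSet = insert s(u, v) (M'.edgeSet \ {s(u, v)}) := by
          rw [Set.insert_sdiff_singleton]
          exact (Set.insert_eq_of_mem (show s(u, v) ∈ M'.edgeSet from huv)).symm
        conv_lhs => rw [this]
        exact finsum_mem_insert _ (fun h => h.2 rfl) (Set.toFinite _)
      linarith
    · have : M.edgeSet \ M''.edgeSet = (M.edgeSet \ M'.edgeSet) \ {s(a, b)} := by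
        rw [hE]
        ext x
        simp only [Set.mem_sdiff, Set.mem_insert_iff, Set.mem_singleton_iff]
        constructor
        · rintro ⟨hx, hx'⟩
          push Not at hx'
          refine ⟨⟨hx, fun hx2 => ?_⟩, hx'.1⟩
          exact hf (hx'.2 hx2 ▸ hx)
        · rintro ⟨⟨hx, hx'⟩, hx2⟩
          exact ⟨hx, fun h => h.elim hx2 (fun h => hx' h.1)⟩
      have h4 : s(a, b) ∈ M.edgeSet \ M'.edgeSet := ⟨he, he'⟩
      rw [this, Set.ncard_sdiff_singleton_of_mem h4, hk]; rfl
    · rw [← edgeSet_subset_edgeSet, hE]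
      intro x hx
      rcases hx with rfl | hx
      · exact hMG he
      · exact edgeSet_subset_edgeSet.2 hM'G hx.1

/-- Any revenue is bounded by the red cost. -/
lemma blueRevenue_le [Fintype V] {T M F : SimpleGraph V} {c p : Sym2 V → ℝ}
    (hT : T.IsTree) (hc : ∀ e ∈ T.edgeSet, 0 ≤ c e)
    (hmin : ∀ M' : SimpleGraph V, IsSpanningTreeOf (T ⊔ F) M' →
        weight T c p M ≤ weight T c p M') :
    blueRevenue T p M ≤ redCost T c := by
  have h := hmin T ⟨le_sup_left, hT⟩
  have h0 : 0 ≤ esum c (M.edgeSet ∩ T.edgeSet) :=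
    esum_nonneg fun e he => hc e he.2
  have h1 : weight T c p T = redCost T c := by
    simp [weight, redCost, esum]
  rw [h1] at h
  unfold weight at h
  unfold blueRevenue
  linarith

lemma redCost_nonneg [Fintype V] {T : SimpleGraph V} {c : Sym2 V → ℝ}
    (hc : ∀ e ∈ T.edgeSet, 0 ≤ c e) : 0 ≤ redCost T c :=
  esum_nonneg fun e he => hc e he

/-- A minimum spanning tree of `T ⊔ F` gives a lower bound on the optimal revenue. -/
lemma le_optRevenue [Fintype V] {T M F : SimpleGraph V} {c p : Sym2 V → ℝ}
    (hT : T.IsTree) (hc : ∀ e ∈ T.edgeSet, 0 ≤ c e) (hF : IsBlueSet T F)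
    (hp : ∀ e ∈ F.edgeSet, 0 ≤ p e) (hM : IsSpanningTreeOf (T ⊔ F) M)
    (hmin : ∀ M' : SimpleGraph V, IsSpanningTreeOf (T ⊔ F) M' →
        weight T c p M ≤ weight T c p M') :
    blueRevenue T p M ≤ optRevenue T c := by
  have hb : ∀ (F : SimpleGraph V) (p : Sym2 V → ℝ), ∀ r ∈ {r | ∃ M : SimpleGraph V,
      IsSpanningTreeOf (T ⊔ F) M ∧ (∀ M' : SimpleGraph V, IsSpanningTreeOf (T ⊔ F) M' →
        weight T c p M ≤ weight T c p M') ∧ r = blueRevenue T p M}, r ≤ redCost T c := by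
    rintro F p r ⟨M, -, h, rfl⟩
    exact blueRevenue_le hT hc h
  have h1 : blueRevenue T p M ≤ followerRevenue T c F p :=
    le_csSup ⟨_, hb F p⟩ ⟨M, hM, hmin, rfl⟩
  refine h1.trans (le_csSup ⟨redCost T c, ?_⟩ ⟨F, p, hF, hp, rfl⟩)
  rintro r ⟨F, p, -, -, rfl⟩
  exact Real.sSup_le (hb F p) (redCost_nonneg hc)

end General

section Strategy

/-- Cost of the `i`-th edge of the path. -/
def pcost {m : ℕ} (c : Sym2 (Fin (m + 1)) → ℝ) (i : Fin m) : ℝ := c s(i.castSucc, i.succ)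

/-- Whether a pair of vertices is an edge of the path. -/
def isRed {m : ℕ} (q : Fin (m + 1) × Fin (m + 1)) : Bool :=
  q.1.val + 1 == q.2.val || q.2.val + 1 == q.1.val

/-- Decidable certificate that the edges `E k`, with cuts `A k` and prices given by the cost of the
red edge `g k`, form a minimum spanning tree as soon as the costs are ordered as `rk`. -/
def Cert {m : ℕ} (rk : Fin m → ℕ) (E : Fin m → Fin (m + 1) × Fin (m + 1))
    (A : Fin m → Fin (m + 1) → Bool) (g : Fin m → Fin m) : Prop :=
  (∀ k l, (A k (E l).1 ≠ A k (E l).2) ↔ k = l) ∧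
  (∀ k, isRed (E k) = true →
    (E k = ((g k).castSucc, (g k).succ))) ∧
  (∀ k i, A k i.castSucc ≠ A k i.succ → rk (g k) ≤ rk i)

instance {m : ℕ} (rk : Fin m → ℕ) (E : Fin m → Fin (m + 1) × Fin (m + 1))
    (A : Fin m → Fin (m + 1) → Bool) (g : Fin m → Fin m) : Decidable (Cert rk E A g) := by
  unfold Cert; infer_instance

lemma isRed_iff {m : ℕ} (u v : Fin (m + 1)) :
    isRed (u, v) = true ↔ s(u, v) ∈ (pathGraph (m + 1)).edgeSet := by
  rw [mem_edgeSet, pathGraph_adj]; simp [isRed]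

lemma path_edge {m : ℕ} {u v : Fin (m + 1)} (h : (pathGraph (m + 1)).Adj u v) :
    ∃ i : Fin m, s(u, v) = s(i.castSucc, i.succ) := by
  rw [pathGraph_adj] at h
  rcases h with h | h
  · exact ⟨⟨u.val, by omega⟩, by
      rw [Sym2.eq_iff]; left; constructor <;> ext <;> simp [h]⟩
  · exact ⟨⟨v.val, by omega⟩, by
      rw [Sym2.eq_iff]; right; constructor <;> ext <;> simp [h]⟩

lemma path_adj {m : ℕ} (i : Fin m) : (pathGraph (m + 1)).Adj i.castSucc i.succ := by
  rw [pathGraph_adj]; simp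

lemma path_inj {m : ℕ} : Function.Injective (fun i : Fin m => s(i.castSucc, i.succ)) := by
  intro i j h
  simp only [Sym2.eq_iff, Fin.ext_iff, Fin.val_castSucc, Fin.val_succ] at h
  ext; omega

lemma path_edgeSet (m : ℕ) : (pathGraph (m + 1)).edgeSet =
    Set.range (fun i : Fin m => s(i.castSucc, i.succ)) := by
  ext e
  induction e with | _ u v
  constructor
  · intro h
    obtain ⟨i, hi⟩ := path_edge h
    exact ⟨i, hi.symm⟩
  · rintro ⟨i, hi⟩
    rw [← hi]; exact path_adj i

lemma esum_range {m : ℕ} {V : Type*} [Fintype V] (w : Sym2 V → ℝ) (f : Fin m → Sym2 V)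
    (hf : Function.Injective f) : esum w (Set.range f) = ∑ i, w (f i) := by
  unfold esum
  rw [finsum_mem_range hf, finsum_eq_sum_of_fintype]

lemma redCost_path {m : ℕ} (c : Sym2 (Fin (m + 1)) → ℝ) :
    redCost (pathGraph (m + 1)) c = ∑ i, pcost c i := by
  unfold redCost
  rw [path_edgeSet, esum_range _ _ path_inj]; rfl

lemma path_isTree (m : ℕ) : (pathGraph (m + 1)).IsTree := by
  rw [isTree_iff_connected_and_card]
  refine ⟨pathGraph_connected m, ?_⟩
  rw [path_edgeSet, Nat.card_range_of_injective path_inj]; simp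

theorem strat {m : ℕ} (c : Sym2 (Fin (m + 1)) → ℝ)
    (hc : ∀ e ∈ (pathGraph (m + 1)).edgeSet, 0 ≤ c e)
    (rk : Fin m → ℕ) (hrk : ∀ i j, rk i ≤ rk j → pcost c i ≤ pcost c j)
    (E : Fin m → Fin (m + 1) × Fin (m + 1))
    (A : Fin m → Fin (m + 1) → Bool) (g : Fin m → Fin m) (hcert : Cert rk E A g) :
    (∑ k, if isRed (E k) then 0 else pcost c (g k)) ≤ optRevenue (pathGraph (m + 1)) c := by
  classical
  obtain ⟨h1, h2, h3⟩ := hcert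
  set ed : Fin m → Sym2 (Fin (m + 1)) := fun k => s((E k).1, (E k).2) with hed
  have hx0 : ∀ i, 0 ≤ pcost c i := fun i => hc _ (path_adj i)
  -- crossing, for edges of the tree
  have hcross : ∀ k l u v, ed l = s(u, v) → (A k u ≠ A k v ↔ k = l) := by
    intro k l u v h
    rw [← h1 k l]
    simp only [hed, Sym2.eq_iff] at h
    rcases h with ⟨h, h'⟩ | ⟨h, h'⟩ <;> rw [h, h']
    exact ne_comm
  have hinj : Function.Injective ed := by
    intro k l h
    exact (hcross k l _ _ h.symm).1 ((h1 k k).2 rfl)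
  have hnd : ∀ k u v, ed k = s(u, v) → u ≠ v := by
    intro k u v h huv
    exact (hcross k k u v h).2 rfl (by rw [huv])
  set T := pathGraph (m + 1) with hT
  set M : SimpleGraph (Fin (m + 1)) := fromEdgeSet (Set.range ed) with hMdef
  have hMadj : ∀ u v, M.Adj u v ↔ ∃ k, ed k = s(u, v) := by
    intro u v
    rw [hMdef, fromEdgeSet_adj]
    constructor
    · rintro ⟨h, -⟩; exact h
    · rintro ⟨k, h⟩; exact ⟨⟨k, h⟩, hnd k u v h⟩
  have hMedge : M.edgeSet = Set.range ed := by
    ext e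
    induction e with | _ u v
    exact hMadj u v
  have hMtree : M.IsTree := by
    apply isTree_of_acyclic_card
    · rw [isAcyclic_iff_forall_adj_isBridge]
      intro u v huv
      obtain ⟨k, hk⟩ := (hMadj u v).1 huv
      rw [isBridge_iff]
      rintro ⟨P⟩
      have hne := (hcross k k u v hk).2 rfl
      obtain ⟨d, -, hd1, hd2⟩ := P.exists_boundary_dart {x | A k x = A k u} rfl
        (fun h => hne h.symm)
      have hd := d.adj
      rw [deleteEdges_adj] at hd
      obtain ⟨l, hl⟩ := (hMadj _ _).1 hd.1
      have : k = l := (hcross k l _ _ hl).1 (fun h => hd2 (by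
        simp only [Set.mem_ofPred_eq] at hd1 ⊢; rw [← h, hd1]))
      subst this
      exact hd.2 (by rw [← hl, hk]; rfl)
    · rw [hMedge, ← Set.image_univ, Set.ncard_image_of_injective _ hinj]
      simp
  set p : Sym2 (Fin (m + 1)) → ℝ := fun e => ∑ k, if e = ed k then pcost c (g k) else 0 with hp
  have hped : ∀ k, p (ed k) = pcost c (g k) := by
    intro k
    simp only [hp]
    rw [Finset.sum_eq_single k]
    · simp
    · intro l _ hl
      rw [if_neg]
      exact fun h => hl (hinj h).symm
    · simp
  set w : Sym2 (Fin (m + 1)) → ℝ := fun e => if e ∈ T.edgeSet then c e else p e with hw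
  have hredc : ∀ k, ed k ∈ T.edgeSet → c (ed k) = pcost c (g k) := by
    intro k hk
    have := h2 k ((isRed_iff _ _).2 hk)
    simp only [hed, pcost]
    rw [this]
  have hwed : ∀ k, w (ed k) = pcost c (g k) := by
    intro k
    simp only [hw]
    split_ifs with h
    · exact hredc k h
    · exact hped k
  have hmin : ∀ M' : SimpleGraph (Fin (m + 1)), IsSpanningTreeOf (T ⊔ (M \ T)) M' →
        weight T c p M ≤ weight T c p M' := by
    rintro M' ⟨hle, hM'⟩
    have hw1 : ∀ e ∈ T.edgeSet, w e = c e := fun e he => if_pos he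
    have hw2 : ∀ e ∉ T.edgeSet, w e = p e := fun e he => if_neg he
    rw [weight_eq T M c p w hw1 hw2, weight_eq T M' c p w hw1 hw2]
    refine mst_of_cuts (G := T ⊔ (M \ T)) hMtree (by simp) w ?_ _ M' rfl hM' hle
    intro a b hab
    obtain ⟨k, hk⟩ := (hMadj a b).1 hab
    have hne := (hcross k k a b hk).2 rfl
    have hM1 : ∀ u v, M.Adj u v → A k u = A k a → ¬ A k v = A k a → s(u, v) = s(a, b) := by
      intro u v huv hu hv
      obtain ⟨l, hl⟩ := (hMadj u v).1 huv
      have : k = l := (hcross k l _ _ hl).1 (fun h => hv (by rw [← h, hu]))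
      subst this
      rw [← hl, hk]
    refine ⟨{x | A k x = A k a}, rfl, fun h => hne h.symm, hM1, ?_⟩
    intro u v huv hu hv
    by_cases hr : T.Adj u v
    · obtain ⟨i, hi⟩ := path_edge hr
      rw [← hk, hwed, hw1 _ hr, hi]
      apply hrk
      apply h3
      have huv' : A k u ≠ A k v := fun h => hv (by
        simp only [Set.mem_ofPred_eq] at hu ⊢; rw [← h, hu])
      rw [Sym2.eq_iff] at hi
      rcases hi with ⟨h, h'⟩ | ⟨h, h'⟩
      · rw [← h, ← h']; exact huv'
      · rw [← h, ← h']; exact huv'.symm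
    · have : M.Adj u v := by
        rw [sup_sdiff_self] at huv
        exact huv.resolve_left hr
      rw [hM1 u v this hu hv]
  have hfin := le_optRevenue (T := T) (M := M) (F := M \ T) (c := c) (p := p) (path_isTree m) hc
    (by
      unfold IsBlueSet
      rw [sdiff_eq]; exact inf_le_right)
    (by
      intro e he
      exact Finset.sum_nonneg fun k _ => by split_ifs; exacts [hx0 _, le_rfl])
    ⟨by simp, hMtree⟩ hmin
  refine le_of_eq_of_le ?_ hfin
  have hset : M.edgeSet \ T.edgeSet = ed '' {k | ¬ isRed (E k) = true} := by
    rw [hMedge]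
    ext e
    constructor
    · rintro ⟨⟨k, rfl⟩, hk⟩
      exact ⟨k, fun h => hk ((isRed_iff _ _).1 h), rfl⟩
    · rintro ⟨k, hk, rfl⟩
      exact ⟨⟨k, rfl⟩, fun h => hk ((isRed_iff _ _).2 h)⟩
  unfold blueRevenue esum
  rw [hset, finsum_mem_image hinj.injOn, finsum_mem_eq_finite_toFinset_sum _ (Set.toFinite _)]
  have hfs : (Set.toFinite {k | ¬ isRed (E k) = true}).toFinset =
      Finset.univ.filter (fun k => ¬ isRed (E k) = true) := by
    ext k; simp
  rw [hfs, Finset.sum_filter]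
  refine Finset.sum_congr rfl fun k _ => ?_
  rw [hped]
  by_cases h : isRed (E k) = true <;> simp [h]

/-- Cuts encoded as bit masks. -/
def bits {m : ℕ} (a : Fin m → ℕ) (k : Fin m) (v : Fin (m + 1)) : Bool := (a k).testBit v.val

lemma exists_rank {m : ℕ} (x : Fin m → ℝ) :
    ∃ ρ : Equiv.Perm (Fin m), ∀ i j, (ρ i).val ≤ (ρ j).val → x i ≤ x j := by
  refine ⟨(Tuple.sort x).symm, fun i j h => ?_⟩
  have := Tuple.monotone_sort x (Fin.le_def.2 h)
  simpa using this

end Strategy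


set_option maxRecDepth 100000 in
lemma ranks_three : ∀ ρ : Equiv.Perm (Fin 3),
    (fun i => (ρ i).val) = ![0, 1, 2] ∨
    (fun i => (ρ i).val) = ![0, 2, 1] ∨
    (fun i => (ρ i).val) = ![1, 0, 2] ∨
    (fun i => (ρ i).val) = ![2, 0, 1] ∨
    (fun i => (ρ i).val) = ![1, 2, 0] ∨
    (fun i => (ρ i).val) = ![2, 1, 0] := by
  decide

theorem three_edges (c : Sym2 (Fin (3 + 1)) → ℝ)
    (hc : ∀ e ∈ (pathGraph (3 + 1)).edgeSet, 0 ≤ c e) :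
    (4 / 7 : ℝ) * ∑ i, pcost c i ≤ optRevenue (pathGraph (3 + 1)) c := by
  obtain ⟨ρ, hρ⟩ := exists_rank (pcost c)
  obtain ⟨rk, hrk', hrk⟩ : ∃ rk : Fin 3 → ℕ, (fun i => (ρ i).val) = rk ∧
      ∀ i j, rk i ≤ rk j → pcost c i ≤ pcost c j := ⟨_, rfl, hρ⟩
  have h0 : ∀ i, 0 ≤ pcost c i := fun i => hc _ (path_adj i)
  have hcase := ranks_three ρ
  rw [hrk'] at hcase
  have z0 := h0 0
  have z1 := h0 1
  have z2 := h0 2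
  rcases hcase with rfl | rfl | rfl | rfl | rfl | rfl
  · -- cost ranks [0, 1, 2]
    have o0 := hrk 0 1 (by decide)
    have o1 := hrk 1 2 (by decide)
    have t0 := strat c hc _ hrk ![(0, 1), (0, 2), (0, 3)] (bits ![13, 11, 7]) ![0, 1, 2] (by decide)
    simp [Fin.sum_univ_succ, isRed] at t0 h0 ⊢
    linarith
  · -- cost ranks [0, 2, 1]
    have o0 := hrk 0 2 (by decide)
    have o1 := hrk 2 1 (by decide)
    have t0 := strat c hc _ hrk ![(0, 1), (0, 2), (0, 3)] (bits ![13, 11, 7]) ![0, 2, 2] (by decide)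
    have t1 := strat c hc _ hrk ![(0, 1), (0, 2), (2, 3)] (bits ![13, 3, 7]) ![0, 1, 2] (by decide)
    have t2 := strat c hc _ hrk ![(0, 2), (0, 3), (1, 3)] (bits ![11, 5, 2]) ![2, 0, 0] (by decide)
    simp [Fin.sum_univ_succ, isRed] at t0 t1 t2 h0 ⊢
    linarith
  · -- cost ranks [1, 0, 2]
    have o0 := hrk 1 0 (by decide)
    have o1 := hrk 0 2 (by decide)
    have t0 := strat c hc _ hrk ![(0, 2), (0, 3), (1, 2)] (bits ![9, 7, 2]) ![0, 2, 1] (by decide)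
    simp [Fin.sum_univ_succ, isRed] at t0 h0 ⊢
    linarith
  · -- cost ranks [2, 0, 1]
    have o0 := hrk 1 2 (by decide)
    have o1 := hrk 2 0 (by decide)
    have t0 := strat c hc _ hrk ![(0, 2), (1, 2), (1, 3)] (bits ![1, 10, 7]) ![0, 1, 2] (by decide)
    simp [Fin.sum_univ_succ, isRed] at t0 h0 ⊢
    linarith
  · -- cost ranks [1, 2, 0]
    have o0 := hrk 2 0 (by decide)
    have o1 := hrk 0 1 (by decide)
    have t0 := strat c hc _ hrk ![(0, 1), (0, 2), (2, 3)] (bits ![13, 3, 7]) ![0, 1, 2] (by decide)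
    have t1 := strat c hc _ hrk ![(0, 2), (0, 3), (1, 3)] (bits ![11, 5, 2]) ![2, 2, 0] (by decide)
    have t2 := strat c hc _ hrk ![(0, 2), (1, 3), (2, 3)] (bits ![1, 2, 5]) ![0, 0, 2] (by decide)
    simp [Fin.sum_univ_succ, isRed] at t0 t1 t2 h0 ⊢
    linarith
  · -- cost ranks [2, 1, 0]
    have o0 := hrk 2 1 (by decide)
    have o1 := hrk 1 0 (by decide)
    have t0 := strat c hc _ hrk ![(0, 2), (1, 3), (2, 3)] (bits ![1, 2, 5]) ![0, 1, 2] (by decide)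
    simp [Fin.sum_univ_succ, isRed] at t0 h0 ⊢
    linarith

set_option maxRecDepth 100000 in
lemma ranks_four : ∀ ρ : Equiv.Perm (Fin 4),
    (fun i => (ρ i).val) = ![0, 1, 2, 3] ∨
    (fun i => (ρ i).val) = ![0, 1, 3, 2] ∨
    (fun i => (ρ i).val) = ![0, 2, 1, 3] ∨
    (fun i => (ρ i).val) = ![0, 3, 1, 2] ∨
    (fun i => (ρ i).val) = ![0, 2, 3, 1] ∨
    (fun i => (ρ i).val) = ![0, 3, 2, 1] ∨
    (fun i => (ρ i).val) = ![1, 0, 2, 3] ∨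
    (fun i => (ρ i).val) = ![1, 0, 3, 2] ∨
    (fun i => (ρ i).val) = ![2, 0, 1, 3] ∨
    (fun i => (ρ i).val) = ![3, 0, 1, 2] ∨
    (fun i => (ρ i).val) = ![2, 0, 3, 1] ∨
    (fun i => (ρ i).val) = ![3, 0, 2, 1] ∨
    (fun i => (ρ i).val) = ![1, 2, 0, 3] ∨
    (fun i => (ρ i).val) = ![1, 3, 0, 2] ∨
    (fun i => (ρ i).val) = ![2, 1, 0, 3] ∨
    (fun i => (ρ i).val) = ![3, 1, 0, 2] ∨
    (fun i => (ρ i).val) = ![2, 3, 0, 1] ∨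
    (fun i => (ρ i).val) = ![3, 2, 0, 1] ∨
    (fun i => (ρ i).val) = ![1, 2, 3, 0] ∨
    (fun i => (ρ i).val) = ![1, 3, 2, 0] ∨
    (fun i => (ρ i).val) = ![2, 1, 3, 0] ∨
    (fun i => (ρ i).val) = ![3, 1, 2, 0] ∨
    (fun i => (ρ i).val) = ![2, 3, 1, 0] ∨
    (fun i => (ρ i).val) = ![3, 2, 1, 0] := by
  decide

theorem four_edges (c : Sym2 (Fin (4 + 1)) → ℝ)
    (hc : ∀ e ∈ (pathGraph (4 + 1)).edgeSet, 0 ≤ c e) :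
    (4 / 7 : ℝ) * ∑ i, pcost c i ≤ optRevenue (pathGraph (4 + 1)) c := by
  obtain ⟨ρ, hρ⟩ := exists_rank (pcost c)
  obtain ⟨rk, hrk', hrk⟩ : ∃ rk : Fin 4 → ℕ, (fun i => (ρ i).val) = rk ∧
      ∀ i j, rk i ≤ rk j → pcost c i ≤ pcost c j := ⟨_, rfl, hρ⟩
  have h0 : ∀ i, 0 ≤ pcost c i := fun i => hc _ (path_adj i)
  have hcase := ranks_four ρ
  rw [hrk'] at hcase
  have z0 := h0 0
  have z1 := h0 1
  have z2 := h0 2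
  have z3 := h0 3
  rcases hcase with rfl | rfl | rfl | rfl | rfl | rfl | rfl | rfl | rfl | rfl | rfl | rfl | rfl | rfl | rfl | rfl | rfl | rfl | rfl | rfl | rfl | rfl | rfl | rfl
  · -- cost ranks [0, 1, 2, 3]
    have o0 := hrk 0 1 (by decide)
    have o1 := hrk 1 2 (by decide)
    have o2 := hrk 2 3 (by decide)
    have t0 := strat c hc _ hrk ![(0, 1), (0, 2), (0, 3), (0, 4)] (bits ![29, 27, 23, 15]) ![0, 1, 2, 3] (by decide)
    simp [Fin.sum_univ_succ, isRed] at t0 h0 ⊢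
    linarith
  · -- cost ranks [0, 1, 3, 2]
    have o0 := hrk 0 1 (by decide)
    have o1 := hrk 1 3 (by decide)
    have o2 := hrk 3 2 (by decide)
    have t0 := strat c hc _ hrk ![(0, 1), (0, 2), (0, 3), (0, 4)] (bits ![29, 27, 23, 15]) ![0, 1, 3, 3] (by decide)
    have t1 := strat c hc _ hrk ![(0, 1), (0, 2), (0, 3), (3, 4)] (bits ![29, 27, 7, 15]) ![0, 1, 2, 3] (by decide)
    simp [Fin.sum_univ_succ, isRed] at t0 t1 h0 ⊢
    linarith
  · -- cost ranks [0, 2, 1, 3]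
    have o0 := hrk 0 2 (by decide)
    have o1 := hrk 2 1 (by decide)
    have o2 := hrk 1 3 (by decide)
    have t0 := strat c hc _ hrk ![(0, 1), (0, 2), (0, 4), (2, 3)] (bits ![29, 19, 15, 23]) ![0, 1, 3, 2] (by decide)
    have t1 := strat c hc _ hrk ![(0, 2), (0, 3), (0, 4), (1, 3)] (bits ![27, 21, 15, 2]) ![2, 0, 3, 0] (by decide)
    simp [Fin.sum_univ_succ, isRed] at t0 t1 h0 ⊢
    linarith
  · -- cost ranks [0, 3, 1, 2]
    have o0 := hrk 0 2 (by decide)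
    have o1 := hrk 2 3 (by decide)
    have o2 := hrk 3 1 (by decide)
    have t0 := strat c hc _ hrk ![(0, 1), (0, 2), (2, 3), (2, 4)] (bits ![29, 3, 23, 15]) ![0, 1, 2, 3] (by decide)
    have t1 := strat c hc _ hrk ![(0, 2), (0, 3), (0, 4), (1, 3)] (bits ![27, 21, 15, 2]) ![2, 0, 3, 0] (by decide)
    simp [Fin.sum_univ_succ, isRed] at t0 t1 h0 ⊢
    linarith
  · -- cost ranks [0, 2, 3, 1]
    have o0 := hrk 0 3 (by decide)
    have o1 := hrk 3 1 (by decide)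
    have o2 := hrk 1 2 (by decide)
    have t0 := strat c hc _ hrk ![(0, 1), (0, 2), (0, 3), (3, 4)] (bits ![29, 27, 7, 15]) ![0, 1, 2, 3] (by decide)
    have t1 := strat c hc _ hrk ![(0, 2), (0, 3), (0, 4), (1, 3)] (bits ![27, 21, 15, 2]) ![1, 0, 3, 0] (by decide)
    simp [Fin.sum_univ_succ, isRed] at t0 t1 h0 ⊢
    linarith
  · -- cost ranks [0, 3, 2, 1]
    have o0 := hrk 0 3 (by decide)
    have o1 := hrk 3 2 (by decide)
    have o2 := hrk 2 1 (by decide)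
    have t0 := strat c hc _ hrk ![(0, 1), (0, 2), (2, 4), (3, 4)] (bits ![29, 3, 7, 8]) ![0, 1, 2, 3] (by decide)
    have t1 := strat c hc _ hrk ![(0, 2), (0, 3), (0, 4), (1, 3)] (bits ![27, 21, 15, 2]) ![2, 0, 3, 0] (by decide)
    simp [Fin.sum_univ_succ, isRed] at t0 t1 h0 ⊢
    linarith
  · -- cost ranks [1, 0, 2, 3]
    have o0 := hrk 1 0 (by decide)
    have o1 := hrk 0 2 (by decide)
    have o2 := hrk 2 3 (by decide)
    have t0 := strat c hc _ hrk ![(0, 2), (0, 3), (0, 4), (1, 2)] (bits ![25, 23, 15, 2]) ![0, 2, 3, 1] (by decide)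
    simp [Fin.sum_univ_succ, isRed] at t0 h0 ⊢
    linarith
  · -- cost ranks [1, 0, 3, 2]
    have o0 := hrk 1 0 (by decide)
    have o1 := hrk 0 3 (by decide)
    have o2 := hrk 3 2 (by decide)
    have t0 := strat c hc _ hrk ![(0, 2), (0, 3), (0, 4), (1, 2)] (bits ![25, 23, 15, 2]) ![0, 3, 3, 1] (by decide)
    have t1 := strat c hc _ hrk ![(0, 2), (0, 3), (1, 2), (3, 4)] (bits ![25, 7, 2, 15]) ![0, 2, 1, 3] (by decide)
    simp [Fin.sum_univ_succ, isRed] at t0 t1 h0 ⊢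
    linarith
  · -- cost ranks [2, 0, 1, 3]
    have o0 := hrk 1 2 (by decide)
    have o1 := hrk 2 0 (by decide)
    have o2 := hrk 0 3 (by decide)
    have t0 := strat c hc _ hrk ![(0, 2), (0, 4), (1, 2), (1, 3)] (bits ![17, 15, 10, 23]) ![0, 3, 1, 2] (by decide)
    simp [Fin.sum_univ_succ, isRed] at t0 h0 ⊢
    linarith
  · -- cost ranks [3, 0, 1, 2]
    have o0 := hrk 1 2 (by decide)
    have o1 := hrk 2 3 (by decide)
    have o2 := hrk 3 0 (by decide)
    have t0 := strat c hc _ hrk ![(0, 2), (1, 2), (1, 3), (1, 4)] (bits ![1, 26, 23, 15]) ![0, 1, 2, 3] (by decide)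
    simp [Fin.sum_univ_succ, isRed] at t0 h0 ⊢
    linarith
  · -- cost ranks [2, 0, 3, 1]
    have o0 := hrk 1 3 (by decide)
    have o1 := hrk 3 0 (by decide)
    have o2 := hrk 0 2 (by decide)
    have t0 := strat c hc _ hrk ![(0, 2), (0, 3), (1, 2), (3, 4)] (bits ![25, 7, 2, 15]) ![0, 2, 1, 3] (by decide)
    have t1 := strat c hc _ hrk ![(0, 2), (1, 3), (1, 4), (2, 4)] (bits ![1, 23, 10, 5]) ![0, 3, 1, 1] (by decide)
    simp [Fin.sum_univ_succ, isRed] at t0 t1 h0 ⊢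
    linarith
  · -- cost ranks [3, 0, 2, 1]
    have o0 := hrk 1 3 (by decide)
    have o1 := hrk 3 2 (by decide)
    have o2 := hrk 2 0 (by decide)
    have t0 := strat c hc _ hrk ![(0, 2), (1, 2), (1, 3), (3, 4)] (bits ![1, 26, 7, 15]) ![0, 1, 2, 3] (by decide)
    have t1 := strat c hc _ hrk ![(0, 2), (1, 3), (1, 4), (2, 4)] (bits ![1, 23, 10, 5]) ![0, 3, 1, 1] (by decide)
    simp [Fin.sum_univ_succ, isRed] at t0 t1 h0 ⊢
    linarith
  · -- cost ranks [1, 2, 0, 3]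
    have o0 := hrk 2 0 (by decide)
    have o1 := hrk 0 1 (by decide)
    have o2 := hrk 1 3 (by decide)
    have t0 := strat c hc _ hrk ![(0, 1), (0, 2), (0, 4), (2, 3)] (bits ![29, 19, 15, 23]) ![0, 1, 3, 2] (by decide)
    have t1 := strat c hc _ hrk ![(0, 2), (0, 4), (1, 3), (2, 3)] (bits ![17, 15, 2, 21]) ![0, 3, 0, 2] (by decide)
    simp [Fin.sum_univ_succ, isRed] at t0 t1 h0 ⊢
    linarith
  · -- cost ranks [1, 3, 0, 2]
    have o0 := hrk 2 0 (by decide)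
    have o1 := hrk 0 3 (by decide)
    have o2 := hrk 3 1 (by decide)
    have t0 := strat c hc _ hrk ![(0, 1), (0, 2), (2, 3), (2, 4)] (bits ![29, 3, 23, 15]) ![0, 1, 2, 3] (by decide)
    have t1 := strat c hc _ hrk ![(0, 2), (0, 3), (0, 4), (1, 3)] (bits ![27, 21, 15, 2]) ![2, 2, 3, 0] (by decide)
    simp [Fin.sum_univ_succ, isRed] at t0 t1 h0 ⊢
    linarith
  · -- cost ranks [2, 1, 0, 3]
    have o0 := hrk 2 1 (by decide)
    have o1 := hrk 1 0 (by decide)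
    have o2 := hrk 0 3 (by decide)
    have t0 := strat c hc _ hrk ![(0, 2), (0, 4), (1, 3), (2, 3)] (bits ![17, 15, 2, 21]) ![0, 3, 1, 2] (by decide)
    simp [Fin.sum_univ_succ, isRed] at t0 h0 ⊢
    linarith
  · -- cost ranks [3, 1, 0, 2]
    have o0 := hrk 2 1 (by decide)
    have o1 := hrk 1 3 (by decide)
    have o2 := hrk 3 0 (by decide)
    have t0 := strat c hc _ hrk ![(0, 2), (1, 3), (1, 4), (2, 3)] (bits ![1, 18, 15, 5]) ![0, 1, 3, 2] (by decide)
    simp [Fin.sum_univ_succ, isRed] at t0 h0 ⊢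
    linarith
  · -- cost ranks [2, 3, 0, 1]
    have o0 := hrk 2 3 (by decide)
    have o1 := hrk 3 0 (by decide)
    have o2 := hrk 0 1 (by decide)
    have t0 := strat c hc _ hrk ![(0, 1), (0, 2), (2, 3), (2, 4)] (bits ![29, 3, 23, 15]) ![0, 1, 2, 3] (by decide)
    have t1 := strat c hc _ hrk ![(0, 2), (1, 3), (2, 3), (2, 4)] (bits ![1, 2, 21, 15]) ![0, 0, 2, 3] (by decide)
    simp [Fin.sum_univ_succ, isRed] at t0 t1 h0 ⊢
    linarith
  · -- cost ranks [3, 2, 0, 1]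
    have o0 := hrk 2 3 (by decide)
    have o1 := hrk 3 1 (by decide)
    have o2 := hrk 1 0 (by decide)
    have t0 := strat c hc _ hrk ![(0, 2), (1, 3), (2, 3), (2, 4)] (bits ![1, 2, 21, 15]) ![0, 1, 2, 3] (by decide)
    simp [Fin.sum_univ_succ, isRed] at t0 h0 ⊢
    linarith
  · -- cost ranks [1, 2, 3, 0]
    have o0 := hrk 3 0 (by decide)
    have o1 := hrk 0 1 (by decide)
    have o2 := hrk 1 2 (by decide)
    have t0 := strat c hc _ hrk ![(0, 1), (0, 2), (0, 3), (3, 4)] (bits ![29, 27, 7, 15]) ![0, 1, 2, 3] (by decide)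
    have t1 := strat c hc _ hrk ![(0, 2), (0, 3), (0, 4), (1, 3)] (bits ![27, 21, 15, 2]) ![1, 3, 3, 0] (by decide)
    simp [Fin.sum_univ_succ, isRed] at t0 t1 h0 ⊢
    linarith
  · -- cost ranks [1, 3, 2, 0]
    have o0 := hrk 3 0 (by decide)
    have o1 := hrk 0 2 (by decide)
    have o2 := hrk 2 1 (by decide)
    have t0 := strat c hc _ hrk ![(0, 1), (0, 2), (2, 4), (3, 4)] (bits ![29, 3, 7, 8]) ![0, 1, 2, 3] (by decide)
    have t1 := strat c hc _ hrk ![(0, 2), (0, 3), (0, 4), (1, 3)] (bits ![27, 21, 15, 2]) ![2, 3, 3, 0] (by decide)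
    simp [Fin.sum_univ_succ, isRed] at t0 t1 h0 ⊢
    linarith
  · -- cost ranks [2, 1, 3, 0]
    have o0 := hrk 3 1 (by decide)
    have o1 := hrk 1 0 (by decide)
    have o2 := hrk 0 2 (by decide)
    have t0 := strat c hc _ hrk ![(0, 2), (0, 3), (1, 2), (3, 4)] (bits ![25, 7, 2, 15]) ![0, 2, 1, 3] (by decide)
    have t1 := strat c hc _ hrk ![(0, 2), (1, 3), (1, 4), (2, 4)] (bits ![1, 23, 10, 5]) ![0, 3, 3, 1] (by decide)
    simp [Fin.sum_univ_succ, isRed] at t0 t1 h0 ⊢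
    linarith
  · -- cost ranks [3, 1, 2, 0]
    have o0 := hrk 3 1 (by decide)
    have o1 := hrk 1 2 (by decide)
    have o2 := hrk 2 0 (by decide)
    have t0 := strat c hc _ hrk ![(0, 2), (1, 2), (1, 3), (3, 4)] (bits ![1, 26, 7, 15]) ![0, 1, 2, 3] (by decide)
    have t1 := strat c hc _ hrk ![(0, 2), (1, 3), (2, 4), (3, 4)] (bits ![1, 2, 5, 10]) ![0, 1, 1, 3] (by decide)
    simp [Fin.sum_univ_succ, isRed] at t0 t1 h0 ⊢
    linarith
  · -- cost ranks [2, 3, 1, 0]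
    have o0 := hrk 3 2 (by decide)
    have o1 := hrk 2 0 (by decide)
    have o2 := hrk 0 1 (by decide)
    have t0 := strat c hc _ hrk ![(0, 1), (0, 2), (2, 4), (3, 4)] (bits ![29, 3, 7, 8]) ![0, 1, 2, 3] (by decide)
    have t1 := strat c hc _ hrk ![(0, 2), (1, 3), (2, 4), (3, 4)] (bits ![1, 2, 5, 10]) ![0, 0, 2, 3] (by decide)
    simp [Fin.sum_univ_succ, isRed] at t0 t1 h0 ⊢
    linarith
  · -- cost ranks [3, 2, 1, 0]
    have o0 := hrk 3 2 (by decide)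
    have o1 := hrk 2 1 (by decide)
    have o2 := hrk 1 0 (by decide)
    have t0 := strat c hc _ hrk ![(0, 2), (1, 3), (2, 4), (3, 4)] (bits ![1, 2, 5, 10]) ![0, 1, 2, 3] (by decide)
    simp [Fin.sum_univ_succ, isRed] at t0 h0 ⊢
    linarith


/-- For the StackMST(0,0) game whose red tree is a path with
exactly 3 or exactly 4 edges (i.e. on 4 or 5 vertices) and nonnegative edge
costs, the optimal revenue satisfies `r*(P, c) ≥ (4/7)·c(P)`. -/
theorem stackMST_short_path_four_sevenths
    (n : ℕ) (hn : n = 4 ∨ n = 5) (c : Sym2 (Fin n) → ℝ)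
    (hc : ∀ e ∈ (SimpleGraph.pathGraph n).edgeSet, 0 ≤ c e) :
    (4 / 7 : ℝ) * redCost (SimpleGraph.pathGraph n) c ≤
      optRevenue (SimpleGraph.pathGraph n) c := by
  rcases hn with rfl | rfl
  · rw [redCost_path (m := 3)]
    exact three_edges c hc
  · rw [redCost_path (m := 4)]
    exact four_edges c hc
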